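/- The generalized precision gP and the generalized recall gR are monotone with respect to the swapping+replacement [rank-based] ordering: if r ≼ s then gP(r) ≤ gP(s) and gR(r) ≤ gR(s). -/

import Mathlib

/-- The swapping+replacement [rank-based] ordering: `r ≼ s` iff for every rank position
`k` and every relevance degree `j`, the number of positions `i ≤ k` of `r` with degree
at least `j` is at most that of `s`. -/
def swapLE {N c : ℕ} (r s : Fin N → Fin (c + 1)) : Prop :=
  ∀ k : Fin N, ∀ j : Fin (c + 1),
    (Finset.univ.filter fun i => i ≤ k ∧ j ≤ r i).card ≤
      (Finset.univ.filter fun i => i ≤ k ∧ j ≤ s i).card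

theorem gain_layer {c : ℕ} (g : Fin (c + 1) → ℝ) (hg0 : g 0 = 0) (x : Fin (c + 1)) :
    g x = ∑ j : Fin c, if j.succ ≤ x then g j.succ - g j.castSucc else 0 := by
  induction x using Fin.induction with
  | zero => simp [hg0]
  | succ x ih =>
    have h : ∀ j : Fin c, (if j.succ ≤ x.succ then g j.succ - g j.castSucc else 0) =
        (if j.succ ≤ x.castSucc then g j.succ - g j.castSucc else 0) +
        (if j = x then g j.succ - g j.castSucc else 0) := by
      intro j
      by_cases hj : j = x
      · subst hj
        simp [Fin.le_def]
      · have h1 : (j.succ ≤ x.succ) ↔ (j.succ ≤ x.castSucc) := by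
          have : (j : ℕ) ≠ x := fun h => hj (Fin.ext h)
          simp only [Fin.le_def, Fin.val_succ, Fin.val_castSucc]
          omega
        simp only [h1, hj, if_false, add_zero]
    rw [Finset.sum_congr rfl (fun j _ => h j), Finset.sum_add_distrib, ← ih]
    simp

theorem gain_sum_le {N c : ℕ} (hN : 1 ≤ N) (g : Fin (c + 1) → ℝ) (hg : StrictMono g)
    (hg0 : g 0 = 0) (r s : Fin N → Fin (c + 1)) (h : swapLE r s) :
    ∑ i, g (r i) ≤ ∑ i, g (s i) := by
  have key : ∀ t : Fin N → Fin (c + 1), ∑ i, g (t i) = ∑ j : Fin c,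
      ((Finset.univ.filter fun i => j.succ ≤ t i).card : ℝ) * (g j.succ - g j.castSucc) := by
    intro t
    rw [Finset.sum_congr rfl (fun i _ => gain_layer g hg0 (t i)), Finset.sum_comm]
    refine Finset.sum_congr rfl fun j _ => ?_
    rw [← Finset.sum_filter, Finset.sum_const, nsmul_eq_mul]
  rw [key r, key s]
  refine Finset.sum_le_sum fun j _ => ?_
  refine mul_le_mul_of_nonneg_right ?_ (sub_nonneg.2 (hg j.castSucc_lt_succ).le)
  have h1 := h ⟨N - 1, by omega⟩ j.succ
  have h2 : ∀ i : Fin N, i ≤ ⟨N - 1, by omega⟩ := fun i => by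
    rw [Fin.le_def]
    have := i.isLt
    simp only
    omega
  simp only [h2, true_and] at h1
  exact_mod_cast h1

/-- Generalized precision and recall are monotone with respect to the
swapping+replacement [rank-based] ordering. -/
theorem swapRepl_gP_gR_isotone (N c : ℕ) (hN : 1 ≤ N) (hc : 1 ≤ c)
    (g : Fin (c + 1) → ℝ) (hg : StrictMono g) (hg0 : g 0 = 0)
    (RB : ℝ) (hRB : 0 < RB)
    (gP gR : (Fin N → Fin (c + 1)) → ℝ)
    (hgP : ∀ r : Fin N → Fin (c + 1),
      gP r = (1 / ((N : ℝ) * g (Fin.last c))) * ∑ i : Fin N, g (r i))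
    (hgR : ∀ r : Fin N → Fin (c + 1),
      gR r = (1 / (RB * g (Fin.last c))) * ∑ i : Fin N, g (r i)) :
    ∀ r s : Fin N → Fin (c + 1), swapLE r s → gP r ≤ gP s ∧ gR r ≤ gR s := by
  intro r s h
  have hs := gain_sum_le hN g hg hg0 r s h
  have hl : 0 ≤ g (Fin.last c) := hg0 ▸ hg.monotone (Fin.zero_le _)
  rw [hgP, hgP, hgR, hgR]
  exact ⟨mul_le_mul_of_nonneg_left hs (by positivity),
    mul_le_mul_of_nonneg_left hs (by positivity)⟩
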